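/- arXiv:math/0007046 — 2 statements merged into one kernel-verified Lean document; each statement's English description precedes it below -/
import Mathlib

section
/- Dougall's ₂H₂ summation: Let a, b, c, d ∈ ℂ, none of which is an integer (so every term of the series below is well-defined with nonzero denominator), and assume Re(c + d - a - b - 1) > 0. Then ∑_{n=-∞}^{∞} (a)_n (b)_n / ( (c)_n (d)_n ) = Γ(1-a) Γ(1-b) Γ(c) Γ(d) Γ(c+d-a-b-1) / ( Γ(c-a) Γ(c-b) Γ(d-a) Γ(d-b) ). -/
/-- The shifted factorial `(a)_k = Γ(a+k)/Γ(a)`, defined for every integer `k`. -/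
noncomputable def shiftedFact (a : ℂ) (k : ℤ) : ℂ := Complex.Gamma (a + k) / Complex.Gamma a

open Filter Topology Asymptotics

/-- Pochhammer -/
noncomputable def poch (z : ℂ) (n : ℕ) : ℂ := ∏ i ∈ Finset.range n, (z + i)

lemma poch_succ (z : ℂ) (n : ℕ) : poch z (n+1) = poch z n * (z + n) := by
  simp [poch, Finset.prod_range_succ]

lemma poch_zero (z : ℂ) : poch z 0 = 1 := by simp [poch]

lemma rGamma_rec (s : ℂ) : (Complex.Gamma s)⁻¹ = s * (Complex.Gamma (s + 1))⁻¹ :=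
  Complex.one_div_Gamma_eq_self_mul_one_div_Gamma_add_one s

lemma rGamma_poch (s : ℂ) (n : ℕ) :
    (Complex.Gamma s)⁻¹ = poch s n * (Complex.Gamma (s + n))⁻¹ := by
  induction n with
  | zero => simp [poch_zero]
  | succ n ih =>
    rw [ih, rGamma_rec (s + n), poch_succ]; push_cast; rw [← add_assoc]; ring

lemma rGamma_sub (s : ℂ) (k : ℕ) :
    (Complex.Gamma (s - k))⁻¹ = (-1)^k * poch (1 - s) k * (Complex.Gamma s)⁻¹ := by
  induction k with
  | zero => simp [poch_zero]
  | succ n ih =>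
    rw [rGamma_rec, show s - ((n+1 : ℕ):ℂ) + 1 = s - n by push_cast; ring, ih, poch_succ]
    push_cast; ring

lemma tendsto_poch (z : ℂ) :
    Tendsto (fun n : ℕ => poch z (n+1) / ((n:ℂ)^z * (n.factorial : ℂ))) atTop
      (𝓝 (Complex.Gamma z)⁻¹) := by
  by_cases h : Complex.Gamma z = 0
  · obtain ⟨m, hm⟩ := Complex.Gamma_eq_zero_iff z |>.1 h
    rw [h, inv_zero]
    apply tendsto_const_nhds.congr'
    filter_upwards [eventually_ge_atTop m] with n hn
    have : poch z (n+1) = 0 := by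
      apply Finset.prod_eq_zero (i := m) (by simp; omega)
      rw [hm]; ring
    rw [this]; simp
  · have := (Complex.GammaSeq_tendsto_Gamma z).inv₀ h
    refine this.congr fun n => ?_
    simp [Complex.GammaSeq, poch]

lemma tendsto_nat_div (p : ℂ) : Tendsto (fun n : ℕ => (n:ℂ) / (p + n + 1)) atTop (𝓝 1) := by
  have h := tendsto_natCast_div_add_atTop (𝕜 := ℂ) (p + 1)
  refine h.congr fun n => ?_
  rw [show p + (n:ℂ) + 1 = n + (p + 1) by ring]

lemma tendsto_rGamma (p : ℂ) :
    Tendsto (fun n : ℕ => ((n:ℂ)^p * (n.factorial : ℂ)) * (Complex.Gamma (p + n + 1))⁻¹) atTop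
      (𝓝 1) := by
  suffices H : ∀ m : ℕ, ∀ p : ℂ, -p.re < m → 
    Tendsto (fun n : ℕ => ((n:ℂ)^p * (n.factorial : ℂ)) * (Complex.Gamma (p + n + 1))⁻¹) atTop
      (𝓝 1) by
    obtain ⟨m, hm⟩ := exists_nat_gt (-p.re)
    exact H m p hm
  intro m
  induction m with
  | zero =>
    intro p hp
    have hp : 0 < p.re := by simpa using hp
    have hg : Complex.Gamma p ≠ 0 := Complex.Gamma_ne_zero_of_re_pos hp
    have h := (Complex.GammaSeq_tendsto_Gamma p).mul_const (Complex.Gamma p)⁻¹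
    rw [mul_inv_cancel₀ hg] at h
    refine h.congr fun n => ?_
    have h2 := rGamma_poch p (n+1)
    have h3 : poch p (n+1) ≠ 0 := by
      intro h0; rw [h0, zero_mul] at h2; exact hg (inv_eq_zero.1 h2)
    rw [h2, Complex.GammaSeq]
    change _ / poch p (n+1) * _ = _
    push_cast; rw [← add_assoc]; field_simp
  | succ m ih =>
    intro p hp
    have h1 := ih (p+1) (by simp; push_cast at hp; linarith)
    have h2 : Tendsto (fun n : ℕ => ((p + n + 1) / n : ℂ)) atTop (𝓝 1) := by
      have := (tendsto_nat_div p).inv₀ one_ne_zero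
      simpa using this
    have h3 := h1.mul h2
    rw [one_mul] at h3
    refine h3.congr' ?_
    filter_upwards [eventually_gt_atTop 0] with n hn
    have hn' : (n:ℂ) ≠ 0 := by exact_mod_cast hn.ne'
    rw [rGamma_rec (p + n + 1), Complex.cpow_add _ _ hn', Complex.cpow_one,
      show p + 1 + (n:ℂ) + 1 = p + n + 1 + 1 by ring]
    field_simp

lemma tendsto_Gamma (p : ℂ) :
    Tendsto (fun n : ℕ => Complex.Gamma (p + n + 1) / ((n:ℂ)^p * (n.factorial : ℂ))) atTop
      (𝓝 1) := by
  have := (tendsto_rGamma p).inv₀ one_ne_zero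
  simpa [div_eq_mul_inv, mul_comm] using this

lemma bigO_of {f X : ℕ → ℂ} {L s : ℂ} (h : Tendsto X atTop (𝓝 L))
    (hf : ∀ n : ℕ, 0 < n → f n = X n * (n:ℂ)^s) :
    f =O[atTop] (fun n : ℕ => (n:ℝ)^(s.re)) := by
  have h1 := h.isBigO_one ℝ
  have h2 : (fun n : ℕ => (n:ℂ)^s) =O[atTop] (fun n : ℕ => (n:ℝ)^(s.re)) := by
    apply IsBigO.of_bound 1
    filter_upwards [eventually_gt_atTop 0] with n hn
    rw [Complex.norm_natCast_cpow_of_pos hn, one_mul]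
    exact le_abs_self _
  refine (h1.mul h2).congr' ?_ ?_
  · filter_upwards [eventually_gt_atTop 0] with n hn
    rw [hf n hn]
  · filter_upwards with n
    rw [one_mul]

lemma cpow_nat_ne {n : ℕ} (hn : 0 < n) (p : ℂ) : (n:ℂ)^p ≠ 0 := by
  have hn' : (n:ℂ) ≠ 0 := by exact_mod_cast hn.ne'
  simp [Complex.cpow_eq_zero_iff, hn']

lemma fact_ne (n : ℕ) : (n.factorial : ℂ) ≠ 0 := by exact_mod_cast n.factorial_ne_zero

/-- `Γ(p+n+1)/Γ(q+n+1) = O(n^{Re(p-q)})`. -/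
lemma isBigO_w (p q : ℂ) :
    (fun n : ℕ => Complex.Gamma (p + n + 1) / Complex.Gamma (q + n + 1))
      =O[atTop] (fun n : ℕ => (n:ℝ)^((p - q).re)) := by
  refine bigO_of ((tendsto_Gamma p).mul (tendsto_rGamma q)) fun n hn => ?_
  have hn' : (n:ℂ) ≠ 0 := by exact_mod_cast hn.ne'
  have h3 := fact_ne n
  have h4 := cpow_nat_ne hn p
  have h5 := cpow_nat_ne hn q
  rw [Complex.cpow_sub _ _ hn']
  field_simp

lemma fact_succ (n : ℕ) : ((n+1).factorial : ℂ) = (n + 1) * n.factorial := by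
  rw [Nat.factorial_succ]; push_cast; ring

/-- `(A)_{n+1}/(n+1)! = O(n^{Re A - 1})`. -/
lemma isBigO_u (A : ℂ) :
    (fun n : ℕ => poch A (n+1) / ((n+1).factorial : ℂ))
      =O[atTop] (fun n : ℕ => (n:ℝ)^((A - 1).re)) := by
  refine bigO_of ((tendsto_poch A).mul (tendsto_nat_div 0)) fun n hn => ?_
  have hn' : (n:ℂ) ≠ 0 := by exact_mod_cast hn.ne'
  have h3 := fact_ne n
  have h4 := cpow_nat_ne hn A
  have h6 : (n:ℂ) + 1 ≠ 0 := by exact_mod_cast n.succ_ne_zero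
  rw [Complex.cpow_sub _ _ hn', Complex.cpow_one, fact_succ, zero_add]
  field_simp

lemma summable_u {A : ℂ} (hA : A.re < 0) :
    Summable (fun n : ℕ => ‖poch A n / (n.factorial : ℂ)‖) := by
  rw [← summable_nat_add_iff 1]
  have h : Summable (fun n : ℕ => (n:ℝ)^((A - 1).re)) := by
    rw [Real.summable_nat_rpow]; simp; linarith
  exact summable_of_isBigO_nat h (isBigO_u A).norm_left

/-- regularized Gauss term -/
noncomputable def gsT (A B C : ℂ) (k : ℕ) : ℂ :=
  poch A k * poch B k / (k.factorial : ℂ) * (Complex.Gamma (C + k))⁻¹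

lemma isBigO_gt (A B C : ℂ) :
    (fun n : ℕ => ((n + 1 : ℕ) : ℂ) * gsT A B C (n+1))
      =O[atTop] (fun n : ℕ => (n:ℝ)^((A + B - C).re)) := by
  refine bigO_of (((tendsto_poch A).mul (tendsto_poch B)).mul (tendsto_rGamma C)) fun n hn => ?_
  have hn' : (n:ℂ) ≠ 0 := by exact_mod_cast hn.ne'
  have h3 := fact_ne n
  have h4 := cpow_nat_ne hn A
  have h5 := cpow_nat_ne hn B
  have h7 := cpow_nat_ne hn C
  have h6 : (n:ℂ) + 1 ≠ 0 := by exact_mod_cast n.succ_ne_zero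
  rw [gsT, Complex.cpow_sub _ _ hn', Complex.cpow_add _ _ hn', fact_succ]
  push_cast
  rw [← add_assoc]
  field_simp

lemma tendsto_gt {A B C : ℂ} (h : 0 < (C - A - B).re) :
    Tendsto (fun n : ℕ => (n : ℂ) * gsT A B C n) atTop (𝓝 0) := by
  rw [← tendsto_add_atTop_iff_nat 1]
  refine (isBigO_gt A B C).trans_tendsto ?_
  have h2 : (A + B - C).re = -(C - A - B).re := by simp; ring
  rw [h2]
  exact (tendsto_rpow_neg_atTop h).comp tendsto_natCast_atTop_atTop

lemma summable_gt {A B C : ℂ} (h : 0 < (C - A - B).re) :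
    Summable (fun n : ℕ => ‖gsT A B C n‖) := by
  rw [← summable_nat_add_iff 1]
  have h2 : Summable (fun n : ℕ => (n:ℝ)^((A + B - C).re - 1)) := by
    rw [Real.summable_nat_rpow]; simp at h ⊢; linarith
  refine summable_of_isBigO_nat h2 (IsBigO.norm_left ?_)
  have h3 : (fun n : ℕ => (((n + 1 : ℕ) : ℂ))⁻¹) =O[atTop] (fun n : ℕ => (n:ℝ)⁻¹) := by
    apply IsBigO.of_bound 1
    filter_upwards [eventually_gt_atTop 0] with n hn
    rw [norm_inv, norm_inv, Complex.norm_natCast, one_mul, Real.norm_natCast]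
    have : (0:ℝ) < n := by exact_mod_cast hn
    gcongr
    simp
  refine (h3.mul (isBigO_gt A B C)).congr' ?_ ?_
  · filter_upwards with n
    have h6 : ((n + 1 : ℕ) : ℂ) ≠ 0 := by exact_mod_cast n.succ_ne_zero
    field_simp
  · filter_upwards [eventually_gt_atTop 0] with n hn
    have : (0:ℝ) < n := by exact_mod_cast hn
    rw [Real.rpow_sub_one this.ne']
    field_simp

lemma gauss_contig {A B C : ℂ} (h : 0 < (C - A - B).re) :
    (C - A) * (C - B) * ∑' k, gsT A B (C+1) k = (C - A - B) * ∑' k, gsT A B C k := by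
  have hs1 : Summable (gsT A B C) := (summable_gt h).of_norm
  have hs2 : Summable (gsT A B (C+1)) :=
    (summable_gt (by simp at h ⊢; linarith)).of_norm
  have key : ∀ k : ℕ, ((k+1 : ℕ) : ℂ) * gsT A B C (k+1) - (k:ℂ) * gsT A B C k =
      (C - A) * (C - B) * gsT A B (C+1) k - (C - A - B) * gsT A B C k := by
    intro k
    have e1 : gsT A B C k = (C + k) * gsT A B (C+1) k := by
      rw [gsT, gsT, rGamma_rec (C+k), show C + 1 + (k:ℂ) = C + k + 1 by ring]; ring
    have e2 : ((k+1 : ℕ) : ℂ) * gsT A B C (k+1) = (A + k) * (B + k) * gsT A B (C+1) k := by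
      rw [gsT, gsT, poch_succ, poch_succ, fact_succ]
      have h3 := fact_ne k
      have h6 : (k:ℂ) + 1 ≠ 0 := by exact_mod_cast k.succ_ne_zero
      push_cast
      rw [show C + 1 + (k:ℂ) = C + (k + 1) by ring]
      field_simp
    rw [e2, e1]; ring
  have hs := ((hs2.hasSum.mul_left ((C - A) * (C - B))).sub (hs1.hasSum.mul_left (C - A - B)))
  have ht := hs.tendsto_sum_nat
  simp_rw [← key] at ht
  have h0 := tendsto_gt h
  have : ∀ n : ℕ, ∑ i ∈ Finset.range n, (((i+1 : ℕ) : ℂ) * gsT A B C (i+1) - (i:ℂ) * gsT A B C i)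
      = (n : ℂ) * gsT A B C n := by
    intro n
    rw [Finset.sum_range_sub (fun i : ℕ => (i:ℂ) * gsT A B C i)]; simp
  simp_rw [this] at ht
  exact sub_eq_zero.1 (tendsto_nhds_unique ht h0)

/-- the right side -/
noncomputable def gR (A B C : ℂ) : ℂ :=
  Complex.Gamma (C - A - B) * (Complex.Gamma (C - A))⁻¹ * (Complex.Gamma (C - B))⁻¹

lemma gR_contig {A B C : ℂ} (h : 0 < (C - A - B).re) :
    (C - A) * (C - B) * gR A B (C+1) = (C - A - B) * gR A B C := by
  have h0 : C - A - B ≠ 0 := by rintro h1; rw [h1] at h; simp at h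
  rw [gR, gR, rGamma_rec (C - A), rGamma_rec (C - B),
    show C + 1 - A - B = C - A - B + 1 by ring, Complex.Gamma_add_one _ h0,
    show C + 1 - A = C - A + 1 by ring, show C + 1 - B = C - B + 1 by ring]
  ring

lemma gauss_cross {A B C : ℂ} (h : 0 < (C - A - B).re) (N : ℕ) :
    (∑' k, gsT A B C k) * gR A B (C + N) = gR A B C * ∑' k, gsT A B (C + N) k := by
  induction N generalizing C with
  | zero => simp; ring
  | succ N ih =>
    have h0 : C - A - B ≠ 0 := by rintro h1; rw [h1] at h; simp at h
    have e := ih (C := C + 1) (by simp at h ⊢; linarith)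
    have e1 := gauss_contig h
    have e2 := gR_contig h
    rw [show C + ((N+1 : ℕ):ℂ) = C + 1 + N by push_cast; ring]
    apply mul_left_cancel₀ h0
    linear_combination (-gR A B (C+1+N)) * e1 + (∑' k, gsT A B (C+1+N) k) * e2
      + (C-A)*(C-B) * e

lemma tendsto_gR (A B C : ℂ) :
    Tendsto (fun N : ℕ => Complex.Gamma (C + (N + 1 : ℕ)) * gR A B (C + (N + 1 : ℕ))) atTop (𝓝 1) := by
  have h := (((tendsto_Gamma C).mul (tendsto_Gamma (C - A - B))).mul
    (tendsto_rGamma (C - A))).mul (tendsto_rGamma (C - B))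
  simp only [mul_one] at h
  refine h.congr' ?_
  filter_upwards [eventually_gt_atTop 0] with n hn
  have hn' : (n:ℂ) ≠ 0 := by exact_mod_cast hn.ne'
  have h3 := fact_ne n
  have h4 := cpow_nat_ne hn A
  have h5 := cpow_nat_ne hn B
  have h7 := cpow_nat_ne hn C
  rw [gR]
  push_cast
  rw [show C + ((n:ℂ) + 1) - A - B = C - A - B + n + 1 by ring,
    show C + ((n:ℂ) + 1) - A = C - A + n + 1 by ring,
    show C + ((n:ℂ) + 1) - B = C - B + n + 1 by ring,
    show C + ((n:ℂ) + 1) = C + n + 1 by ring]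
  rw [Complex.cpow_sub _ _ hn', Complex.cpow_sub _ _ hn', Complex.cpow_sub _ _ hn']
  field_simp

lemma tendsto_gauss {A B C : ℂ} (h : 0 < (C - A - B).re) :
    Tendsto (fun N : ℕ => Complex.Gamma (C + (N + 1 : ℕ)) * ∑' k, gsT A B (C + (N + 1 : ℕ)) k)
      atTop (𝓝 1) := by
  obtain ⟨M, hM⟩ := exists_nat_gt (-C.re)
  have hMp : 0 < (C + M).re := by simp; linarith
  have e1 : ∀ N : ℕ, M ≤ N → ∀ k : ℕ, Complex.Gamma (C + (N + 1 : ℕ)) * gsT A B (C + (N + 1 : ℕ)) k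
      = poch A k * poch B k / (k.factorial : ℂ) * (poch (C + (N+1 : ℕ)) k)⁻¹ := by
    intro N hN k
    have hre : 0 < (C + (N + 1 : ℕ)).re := by
      have : (M:ℝ) ≤ N := by exact_mod_cast hN
      simp at hMp ⊢; linarith
    have hg := Complex.Gamma_ne_zero_of_re_pos hre
    have h2 := rGamma_poch (C + (N + 1 : ℕ)) k
    have h3 : poch (C + (N + 1 : ℕ)) k ≠ 0 := by
      intro h0; rw [h0, zero_mul] at h2; exact hg (inv_eq_zero.1 h2)
    rw [gsT]
    have h4 : (Complex.Gamma (C + (N + 1 : ℕ) + k))⁻¹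
      = (poch (C + (N + 1 : ℕ)) k)⁻¹ * (Complex.Gamma (C + (N + 1 : ℕ)))⁻¹ := by
      rw [h2]; field_simp
    rw [h4]; field_simp
  have hsum : Summable (fun k : ℕ => ‖Complex.Gamma (C + (M + 1 : ℕ)) * gsT A B (C + (M + 1 : ℕ)) k‖) := by
    simp_rw [norm_mul]
    exact (summable_gt (by simp at h ⊢; linarith)).mul_left _
  have hone : (1 : ℂ) = ∑' k : ℕ, if k = 0 then 1 else 0 := by simp
  rw [hone]
  simp_rw [← tsum_mul_left]
  refine tendsto_tsum_of_dominated_convergence hsum ?_ ?_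
  · intro k
    rcases k with _ | k
    · refine tendsto_const_nhds.congr' ?_
      filter_upwards [eventually_ge_atTop M] with N hN
      rw [e1 N hN]; simp [poch_zero]
    · simp only [Nat.add_eq_zero_iff, one_ne_zero, and_false, if_false]
      have : Tendsto (fun N : ℕ => poch A (k+1) * poch B (k+1) / ((k+1).factorial : ℂ) *
        ∏ i ∈ Finset.range (k+1), (C + (N+1 : ℕ) + i)⁻¹) atTop
          (𝓝 (poch A (k+1) * poch B (k+1) / ((k+1).factorial : ℂ) *
        ∏ i ∈ Finset.range (k+1), 0)) := by
        refine Tendsto.const_mul _ (tendsto_finsetProd _ fun i _ => ?_)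
        apply tendsto_inv₀_cobounded.comp
        rw [← tendsto_norm_atTop_iff_cobounded]
        refine tendsto_atTop_mono (f := fun N : ℕ => (N:ℝ) + (C.re + 1 + i)) (fun N => ?_)
          (tendsto_atTop_add_const_right _ _ tendsto_natCast_atTop_atTop)
        refine le_trans (le_of_eq ?_) (Complex.re_le_norm _)
        simp; ring
      simp only [Finset.prod_const, Finset.card_range, ne_eq, Nat.add_eq_zero_iff, one_ne_zero, and_false, not_false_eq_true, zero_pow, mul_zero] at this
      refine this.congr' ?_
      filter_upwards [eventually_ge_atTop M] with N hN
      rw [e1 N hN]; simp [poch]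
  · filter_upwards [eventually_ge_atTop M] with N hN k
    rw [e1 N hN, e1 M le_rfl, norm_mul, norm_mul _ (_⁻¹)]
    refine mul_le_mul_of_nonneg_left ?_ (norm_nonneg _)
    rw [poch, poch, ← Finset.prod_inv_distrib, ← Finset.prod_inv_distrib, norm_prod, norm_prod]
    refine Finset.prod_le_prod (fun _ _ => norm_nonneg _) fun i _ => ?_
    have hNM : (M:ℝ) ≤ N := by exact_mod_cast hN
    rw [norm_inv, norm_inv]
    have hre : 0 < (C + (M+1 : ℕ) + i).re := by
      have : (0:ℝ) ≤ i := Nat.cast_nonneg i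
      simp at hMp ⊢; linarith
    have hpos : 0 < ‖C + (M+1 : ℕ) + i‖ := hre.trans_le (Complex.re_le_norm _)
    apply inv_anti₀ hpos
    rw [Complex.norm_def, Complex.norm_def]
    apply Real.sqrt_le_sqrt
    rw [Complex.normSq_apply, Complex.normSq_apply]
    simp at hre ⊢
    nlinarith

lemma gauss {A B C : ℂ} (h : 0 < (C - A - B).re) :
    ∑' k, gsT A B C k = gR A B C := by
  have h1 := (tendsto_gR A B C).const_mul (∑' k, gsT A B C k)
  have h2 := (tendsto_gauss h).const_mul (gR A B C)
  rw [mul_one] at h1 h2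
  refine tendsto_nhds_unique h1 (h2.congr fun N => ?_)
  have := gauss_cross h (N+1)
  linear_combination (-Complex.Gamma (C + (N + 1 : ℕ))) * this

/-- not an integer -/
def NI (z : ℂ) : Prop := ∀ n : ℤ, z ≠ (n : ℂ)

lemma NI.add {z : ℂ} (h : NI z) (m : ℤ) : NI (z + m) := by
  intro n hn
  exact h (n - m) (by push_cast; rw [← hn]; ring)

lemma NI.addN {z : ℂ} (h : NI z) (m : ℕ) : NI (z + m) := by
  have := h.add m
  simpa using this

lemma NI.one_sub {z : ℂ} (h : NI z) : NI (1 - z) := by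
  intro n hn
  exact h (1 - n) (by push_cast; rw [← hn]; ring)

lemma NI.ne_zero {z : ℂ} (h : NI z) : z ≠ 0 := by simpa using h 0

lemma NI.mem {z : ℂ} (h : NI z) : z ∈ Complex.integerComplement := by
  rw [Complex.mem_integerComplement_iff]
  rintro ⟨n, hn⟩
  exact h n hn.symm

lemma NI.sin {z : ℂ} (h : NI z) : Complex.sin (Real.pi * z) ≠ 0 := sin_pi_mul_ne_zero h.mem

lemma NI.Gamma {z : ℂ} (h : NI z) : Complex.Gamma z ≠ 0 :=
  Complex.Gamma_ne_zero fun m hm => h (-m) (by simpa using hm)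

lemma sin_add_nat (a : ℂ) (k : ℕ) :
    Complex.sin (Real.pi * (a + k)) = (-1)^k * Complex.sin (Real.pi * a) := by
  induction k with
  | zero => simp
  | succ k ih =>
    rw [show (Real.pi:ℂ) * (a + (k+1 : ℕ)) = Real.pi * (a + k) + Real.pi by push_cast; ring,
      Complex.sin_add_pi, ih]; ring

lemma inv_bigO (α : ℂ) : (fun n : ℕ => (α + (n+1 : ℕ))⁻¹) =O[atTop] (fun n : ℕ => (n:ℝ)^(-1:ℝ)) := by
  have := bigO_of (f := fun n : ℕ => (α + (n+1 : ℕ))⁻¹) (s := -1) (tendsto_nat_div α) (fun n hn => by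
    have hn' : (n:ℂ) ≠ 0 := by exact_mod_cast hn.ne'
    rw [Complex.cpow_neg_one]; push_cast
    rw [add_assoc]
    field_simp)
  simpa using this

lemma sq_summable_nat (α : ℂ) : Summable (fun n : ℕ => ‖(α + n)⁻¹‖^2) := by
  rw [← summable_nat_add_iff 1]
  have h : Summable (fun n : ℕ => (n:ℝ)^(-2:ℝ)) := by
    rw [Real.summable_nat_rpow]; norm_num
  refine summable_of_isBigO_nat h ?_
  refine ((inv_bigO α).norm_left.pow 2).congr_right fun n => ?_
  rw [← Real.rpow_natCast, ← Real.rpow_mul (by positivity)]; norm_num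

lemma sq_summable (α : ℂ) : Summable (fun n : ℤ => ‖(α + n)⁻¹‖^2) := by
  refine Summable.of_nat_of_neg ?_ ?_
  · simpa using sq_summable_nat α
  · refine (sq_summable_nat (-α)).congr fun n => ?_
    rw [← norm_neg, ← inv_neg]; push_cast; rw [show -(-α + (n:ℂ)) = α + -n by ring]

lemma inv_bdd (α : ℂ) : ∃ K : ℝ, 0 < K ∧ ∀ n : ℤ, ‖(α + n)⁻¹‖ ≤ K := by
  refine ⟨Real.sqrt (∑' n : ℤ, ‖(α + n)⁻¹‖^2) + 1, by positivity, fun n => ?_⟩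
  have := (sq_summable α).le_tsum n (fun _ _ => by positivity)
  have := Real.le_sqrt_of_sq_le this
  linarith

lemma summable_U (α β : ℂ) : Summable (fun n : ℤ => (α + n)⁻¹ * (β + n)⁻¹) := by
  refine Summable.of_norm_bounded ((sq_summable α).add (sq_summable β)) fun n => ?_
  rw [norm_mul]
  nlinarith [sq_nonneg (‖(α + n)⁻¹‖ - ‖(β + n)⁻¹‖), sq_nonneg (‖(α + n)⁻¹‖), sq_nonneg (‖(β + n)⁻¹‖)]

lemma rGamma_refl (h : ℂ) : h * (Complex.Gamma (1 + h))⁻¹ * (Complex.Gamma (1 - h))⁻¹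
    = Complex.sin (Real.pi * h) / Real.pi := by
  have e := Complex.Gamma_mul_Gamma_one_sub h
  have e1 := congrArg (·⁻¹) e
  simp only [mul_inv, inv_div] at e1
  rw [rGamma_rec h, add_comm h 1] at e1
  exact e1

lemma tsum_U_ne {α β : ℂ} (ha : NI α) (hb : NI β) (hne : α ≠ β) :
    ∑' n : ℤ, (α + n)⁻¹ * (β + n)⁻¹ =
      Real.pi^2 / (Complex.sin (Real.pi * α) * Complex.sin (Real.pi * β)) *
        (Complex.Gamma (1 + α - β))⁻¹ * (Complex.Gamma (1 + β - α))⁻¹ := by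
  have hs := (summable_U α β).hasSum.mul_left (α - β)
  set V := ∑' n : ℤ, (α + n)⁻¹ * (β + n)⁻¹ with hV
  have hf : ∀ n : ℤ, (α - β) * ((α + n)⁻¹ * (β + n)⁻¹) = (β + n)⁻¹ - (α + n)⁻¹ := by
    intro n
    have h1 := (ha.add n).ne_zero
    have h2 := (hb.add n).ne_zero
    field_simp; ring
  simp_rw [hf] at hs
  have h1 := (hasSum_nat_add_iff' 1).2 hs.nat_add_neg
  have ca := (summable_cotTerm ha.mem).hasSum
  have cb := (summable_cotTerm hb.mem).hasSum
  have ea := cot_series_rep' ha.mem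
  have eb := cot_series_rep' hb.mem
  have h2 := cb.sub ca
  have h3 := h1.unique (h2.congr_fun fun n => by
    simp only [cotTerm, one_div]; push_cast; ring_nf)
  simp only [cotTerm] at h3
  rw [← ea, ← eb] at h3
  simp at h3
  have hd : α - β ≠ 0 := sub_ne_zero.2 hne
  have hr := rGamma_refl (α - β)
  have sa := ha.sin
  have sb := hb.sin
  have e4 : (α - β) * V = Real.pi * (Complex.cot (Real.pi * β) - Complex.cot (Real.pi * α)) := by
    linear_combination h3
  have e5 : Complex.cot (Real.pi * β) - Complex.cot (Real.pi * α) =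
      Complex.sin (Real.pi * (α - β)) / (Complex.sin (Real.pi * α) * Complex.sin (Real.pi * β)) := by
    rw [Complex.cot, Complex.cot, mul_sub, Complex.sin_sub]
    field_simp
  have hpi : (Real.pi : ℂ) ≠ 0 := by exact_mod_cast Real.pi_ne_zero
  have e6 : Complex.sin (Real.pi * (α - β)) = Real.pi * ((α - β) * (Complex.Gamma (1 + (α - β)))⁻¹ * (Complex.Gamma (1 - (α - β)))⁻¹) := by
    rw [hr]; field_simp
  apply mul_left_cancel₀ hd
  rw [e4, e5, e6, show 1 + (α - β) = 1 + α - β by ring, show 1 - (α - β) = 1 + β - α by ring]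
  field_simp

lemma tsum_U {α β : ℂ} (ha : NI α) (hb : NI β) :
    ∑' n : ℤ, (α + n)⁻¹ * (β + n)⁻¹ =
      Real.pi^2 / (Complex.sin (Real.pi * α) * Complex.sin (Real.pi * β)) *
        (Complex.Gamma (1 + α - β))⁻¹ * (Complex.Gamma (1 + β - α))⁻¹ := by
  by_cases hne : α = β
  swap
  · exact tsum_U_ne ha hb hne
  subst hne
  obtain ⟨K, hK, hKb⟩ := inv_bdd α
  have hlow : ∀ n : ℤ, 1 / K ≤ ‖α + n‖ := by
    intro n
    have := hKb n
    rw [norm_inv] at this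
    rw [one_div]; exact inv_le_of_inv_le₀ (norm_pos_iff.2 (ha.add n).ne_zero) this
  have hε : Tendsto (fun m : ℕ => 1 / ((m:ℝ) + 1)) atTop (𝓝 0) := tendsto_one_div_add_atTop_nhds_zero_nat
  have hεC : Tendsto (fun m : ℕ => 1 / ((m:ℂ) + 1)) atTop (𝓝 0) := tendsto_one_div_add_atTop_nhds_zero_nat
  have hα : Tendsto (fun m : ℕ => α + 1 / ((m:ℂ) + 1)) atTop (𝓝 α) := by
    simpa using hεC.const_add α
  have hev : ∀ᶠ m : ℕ in atTop, ∀ n : ℤ, ‖α + n‖ / 2 ≤ ‖α + 1 / ((m:ℂ)+1) + n‖ := by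
    filter_upwards [hε.eventually (gt_mem_nhds (show (0:ℝ) < 1 / K / 2 by positivity))] with m hm n
    have h1 := hlow n
    have h2 : ‖(1 / ((m:ℂ)+1))‖ = 1 / ((m:ℝ)+1) := by
      rw [norm_div, norm_one]; congr 1
      exact_mod_cast Complex.norm_natCast (m+1)
    have h3 : ‖α + n‖ ≤ ‖α + 1 / ((m:ℂ)+1) + n‖ + ‖(1 / ((m:ℂ)+1))‖ := by
      have := norm_sub_le (α + 1 / ((m:ℂ)+1) + n) (1 / ((m:ℂ)+1))
      rwa [show α + 1 / ((m:ℂ)+1) + n - 1 / ((m:ℂ)+1) = α + n by ring] at this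
    linarith
  have L1 : Tendsto (fun m : ℕ => ∑' n : ℤ, (α + 1 / ((m:ℂ)+1) + n)⁻¹ * (α + n)⁻¹) atTop
      (𝓝 (∑' n : ℤ, (α + n)⁻¹ * (α + n)⁻¹)) := by
    refine tendsto_tsum_of_dominated_convergence ((sq_summable α).mul_left 2) ?_ ?_
    · intro n
      exact ((hα.add_const _).inv₀ (ha.add n).ne_zero).mul_const _
    · filter_upwards [hev] with m hm n
      have h1 := hm n
      have h0 : 0 < ‖α + n‖ := norm_pos_iff.2 (ha.add n).ne_zero
      rw [norm_mul, norm_inv, norm_inv, pow_two, ← mul_assoc]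
      gcongr
      rw [show 2 * ‖α + (n:ℂ)‖⁻¹ = (‖α + (n:ℂ)‖/2)⁻¹ by field_simp]
      exact inv_anti₀ (by positivity) h1
  have hG : Continuous (fun s : ℂ => (Complex.Gamma s)⁻¹) :=
    Complex.differentiable_one_div_Gamma.continuous
  have L2 : Tendsto (fun m : ℕ => Real.pi^2 / (Complex.sin (Real.pi * (α + 1 / ((m:ℂ)+1))) * Complex.sin (Real.pi * α)) *
        (Complex.Gamma (1 + (α + 1 / ((m:ℂ)+1)) - α))⁻¹ * (Complex.Gamma (1 + α - (α + 1 / ((m:ℂ)+1))))⁻¹) atTop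
      (𝓝 (Real.pi^2 / (Complex.sin (Real.pi * α) * Complex.sin (Real.pi * α)) *
        (Complex.Gamma (1 + α - α))⁻¹ * (Complex.Gamma (1 + α - α))⁻¹)) := by
    refine Tendsto.mul (Tendsto.mul (Tendsto.div tendsto_const_nhds ?_ (mul_ne_zero ha.sin ha.sin)) ?_) ?_
    · exact ((Complex.continuous_sin.tendsto _).comp (hα.const_mul _)).mul_const _
    · exact (hG.tendsto _).comp ((hα.const_add 1).sub_const α)
    · exact (hG.tendsto _).comp (hα.const_sub (1 + α))
  refine tendsto_nhds_unique L1 (L2.congr' ?_)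
  filter_upwards [hev] with m hm
  rw [tsum_U_ne _ ha]
  · have : (1 / ((m:ℂ)+1)) ≠ 0 := by
      apply one_div_ne_zero; exact_mod_cast m.succ_ne_zero
    simpa using this
  · intro n hn
    have h1 := hm (-n)
    rw [hn] at h1
    have h0 : 0 < ‖α + (-n : ℤ)‖ := norm_pos_iff.2 (ha.add (-n)).ne_zero
    simp at h1 h0
    exact absurd h1 (by simpa using h0)

lemma beta_exp {A z : ℂ} (hz : NI z) (hA : A.re < 1) :
    ∑' j : ℕ, poch A j / (j.factorial : ℂ) * (z + j)⁻¹ =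
      Complex.Gamma (1 - A) * (Complex.Gamma z / Complex.Gamma (z + 1 - A)) := by
  have h := gauss (A := A) (B := z) (C := z + 1) (by simp; linarith)
  have hg := hz.Gamma
  have e : ∀ j : ℕ, gsT A z (z+1) j =
      (Complex.Gamma z)⁻¹ * (poch A j / (j.factorial : ℂ) * (z + j)⁻¹) := by
    intro j
    have h2 := rGamma_poch z j
    have h3 := rGamma_rec (z + j)
    have h4 := (hz.addN j).ne_zero
    rw [gsT, h2, h3, show z + 1 + (j:ℂ) = z + j + 1 by ring]
    field_simp
  simp_rw [e, tsum_mul_left, gR] at h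
  rw [show z + 1 - A - z = 1 - A by ring, show z + 1 - z = (1:ℂ) by ring, Complex.Gamma_one] at h
  apply mul_left_cancel₀ (inv_ne_zero hg)
  rw [h]; field_simp

/-- bilateral term -/
noncomputable def bw (a c : ℂ) (n : ℤ) : ℂ := Complex.Gamma (a + n) / Complex.Gamma (c + n)

lemma bw_nat (a c : ℂ) (n : ℕ) :
    bw a c (n + 1 : ℕ) = Complex.Gamma (a + n + 1) / Complex.Gamma (c + n + 1) := by
  rw [bw]; push_cast; rw [← add_assoc, ← add_assoc]

lemma bw_neg {a c : ℂ} (ha : NI a) (hc : NI c) (n : ℕ) :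
    bw a c (-(n:ℤ)) = Complex.sin (Real.pi * c) / Complex.sin (Real.pi * a) *
      bw (1 - c) (1 - a) n := by
  have key : ∀ z : ℂ, NI z → Complex.Gamma (z - n) =
      (-1)^n * Real.pi / Complex.sin (Real.pi * z) / Complex.Gamma (1 - z + n) := by
    intro z hz
    have h1 := Complex.Gamma_mul_Gamma_one_sub (z - n)
    have h2 := sin_add_nat (z - n) n
    rw [sub_add_cancel] at h2
    have hg : Complex.Gamma (1 - z + n) ≠ 0 := (hz.one_sub.addN n).Gamma
    have hs := hz.sin
    rw [show 1 - (z - (n:ℂ)) = 1 - z + n by ring] at h1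
    rw [eq_div_iff hg, h1, h2]
    have hs' : Complex.sin (Real.pi * (z - n)) ≠ 0 := by
      intro h0; rw [h0] at h2; simp at h2; exact hs h2
    have : ((-1:ℂ)^n) ≠ 0 := pow_ne_zero _ (by norm_num)
    field_simp
  rw [bw, bw]
  push_cast
  rw [← sub_eq_add_neg, ← sub_eq_add_neg, key a ha, key c hc]
  have hs1 := ha.sin
  have hs2 := hc.sin
  have hg1 : Complex.Gamma (1 - a + n) ≠ 0 := (ha.one_sub.addN n).Gamma
  have hg2 : Complex.Gamma (1 - c + n) ≠ 0 := (hc.one_sub.addN n).Gamma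
  have : ((-1:ℂ)^n) ≠ 0 := pow_ne_zero _ (by norm_num)
  have hpi : (Real.pi : ℂ) ≠ 0 := by exact_mod_cast Real.pi_ne_zero
  field_simp

lemma bw_pos_bigO (a c : ℂ) :
    (fun n : ℕ => bw a c (n+1 : ℕ)) =O[atTop] (fun n : ℕ => (n:ℝ)^((a - c).re)) := by
  simp_rw [bw_nat]; exact isBigO_w a c

lemma bw_neg_bigO {a c : ℂ} (ha : NI a) (hc : NI c) :
    (fun n : ℕ => bw a c (-((n+1 : ℕ) : ℤ))) =O[atTop] (fun n : ℕ => (n:ℝ)^((a - c).re)) := by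
  simp_rw [bw_neg ha hc]
  have := (bw_pos_bigO (1 - c) (1 - a)).const_mul_left
    (Complex.sin (Real.pi * c) / Complex.sin (Real.pi * a))
  rwa [show 1 - c - (1 - a) = a - c by ring] at this

lemma summable_int {f : ℤ → ℂ} {s : ℝ} (hs : s < -1)
    (h1 : (fun n : ℕ => f (n+1 : ℕ)) =O[atTop] (fun n : ℕ => (n:ℝ)^s))
    (h2 : (fun n : ℕ => f (-((n+1 : ℕ) : ℤ))) =O[atTop] (fun n : ℕ => (n:ℝ)^s)) :
    Summable (fun n => ‖f n‖) := by
  have h : Summable (fun n : ℕ => (n:ℝ)^s) := Real.summable_nat_rpow.2 hs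
  refine Summable.of_nat_of_neg ?_ ?_
  · rw [← summable_nat_add_iff 1]; exact summable_of_isBigO_nat h h1.norm_left
  · rw [← summable_nat_add_iff 1]; exact summable_of_isBigO_nat h h2.norm_left

lemma summable_bw {a c : ℂ} (ha : NI a) (hc : NI c) (h : 1 < (c - a).re) :
    Summable (fun n => ‖bw a c n‖) :=
  summable_int (s := (a - c).re) (by simp at h ⊢; linarith) (bw_pos_bigO a c) (bw_neg_bigO ha hc)

lemma bw_exp {a c : ℂ} (ha : NI a) (h : 1 < (c - a).re) (n : ℤ) :
    bw a c n = (Complex.Gamma (c - a))⁻¹ *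
      ∑' j : ℕ, poch (1 + a - c) j / (j.factorial : ℂ) * (a + j + n)⁻¹ := by
  have hg : Complex.Gamma (c - a) ≠ 0 := Complex.Gamma_ne_zero_of_re_pos (by linarith)
  have := beta_exp (A := 1 + a - c) (ha.add n) (by simp at h ⊢; linarith)
  rw [show 1 - (1 + a - c) = c - a by ring, show a + (n:ℂ) + 1 - (1 + a - c) = c + n by ring] at this
  simp_rw [show ∀ j : ℕ, a + (j:ℂ) + n = a + n + j by intro j; ring]
  rw [this, bw]; field_simp

lemma sign_aux {s p q f x y g g' P : ℂ} (hs : s ≠ 0) :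
    p / f * (P / (s * x * y) * g * (s * q * g')) = P / (x * y) * g' * (p * q / f * g) := by
  field_simp

lemma T_sum {a c β : ℂ} (ha : NI a) (hβ : NI β) (h : 1 < (c - a).re) :
    ∑' n : ℤ, bw a c n * (β + n)⁻¹ =
      Real.pi^2 / (Complex.sin (Real.pi * a) * Complex.sin (Real.pi * β)) *
        (Complex.Gamma (c - β))⁻¹ * (Complex.Gamma (1 + β - a))⁻¹ := by
  have hg : Complex.Gamma (c - a) ≠ 0 := Complex.Gamma_ne_zero_of_re_pos (by linarith)
  set u : ℕ → ℂ := fun j => poch (1 + a - c) j / (j.factorial : ℂ) with hu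
  have hus : Summable (fun j => ‖u j‖) := summable_u (by simp at h ⊢; linarith)
  have hsum : Summable (Function.uncurry fun (j : ℕ) (n : ℤ) => u j * ((a + j + n)⁻¹ * (β + n)⁻¹)) := by
    have b1 : Summable (fun x : ℕ × ℤ => ‖u x.1‖ * ‖(a + x.2)⁻¹‖^2) :=
      hus.mul_of_nonneg (sq_summable a) (fun _ => norm_nonneg _) (fun _ => by positivity)
    have b2 : Summable (fun x : ℕ × ℤ => ‖u x.1‖ * ‖(β + x.2)⁻¹‖^2) :=
      hus.mul_of_nonneg (sq_summable β) (fun _ => norm_nonneg _) (fun _ => by positivity)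
    have b3 := (Equiv.summable_iff (Equiv.prodShear (Equiv.refl ℕ)
      (fun j : ℕ => Equiv.addRight (j:ℤ)))).2 b1
    refine Summable.of_norm_bounded (b3.add b2) ?_
    rintro ⟨j, n⟩
    simp only [Function.uncurry, Function.comp, Equiv.prodShear_apply, Equiv.refl_apply,
      Equiv.coe_addRight, norm_mul]
    push_cast
    rw [show a + ((n:ℂ) + j) = a + j + n by ring, ← mul_add]
    gcongr
    nlinarith [sq_nonneg (‖(a + j + n)⁻¹‖ - ‖(β + n)⁻¹‖), sq_nonneg (‖(a + j + n)⁻¹‖), sq_nonneg (‖(β + n)⁻¹‖)]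
  have e1 : ∀ n : ℤ, bw a c n * (β + n)⁻¹ = (Complex.Gamma (c - a))⁻¹ *
      ∑' j : ℕ, u j * ((a + j + n)⁻¹ * (β + n)⁻¹) := by
    intro n
    rw [bw_exp ha h, mul_assoc, ← tsum_mul_right]
    simp_rw [mul_assoc, hu]
  simp_rw [e1]
  rw [tsum_mul_left, hsum.tsum_comm]
  simp_rw [tsum_mul_left]
  have e2 : ∀ j : ℕ, u j * ∑' n : ℤ, (a + j + n)⁻¹ * (β + n)⁻¹ =
      Real.pi^2 / (Complex.sin (Real.pi * a) * Complex.sin (Real.pi * β)) *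
        (Complex.Gamma (1 + β - a))⁻¹ * gsT (1 + a - c) (a - β) (1 + a - β) j := by
    intro j
    rw [tsum_U (ha.addN j) hβ, sin_add_nat, gsT]
    have h1 := rGamma_sub (1 + β - a) j
    rw [show 1 + β - (a + (j:ℂ)) = 1 + β - a - j by ring, h1,
      show 1 - (1 + β - a) = a - β by ring, show 1 + (a + (j:ℂ)) - β = 1 + a - β + j by ring, hu]
    have : ((-1:ℂ)^j) ≠ 0 := pow_ne_zero _ (by norm_num)
    exact sign_aux this
  simp_rw [e2]
  rw [tsum_mul_left, gauss (by simp at h ⊢; linarith), gR,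
    show 1 + a - β - (1 + a - c) - (a - β) = c - a by ring,
    show 1 + a - β - (1 + a - c) = c - β by ring, show 1 + a - β - (a - β) = (1:ℂ) by ring,
    Complex.Gamma_one]
  field_simp

/-- right side -/
noncomputable def dR (a b c d : ℂ) : ℂ :=
  Real.pi^2 / (Complex.sin (Real.pi * a) * Complex.sin (Real.pi * b)) *
    Complex.Gamma (c + d - a - b - 1) * (Complex.Gamma (c - a))⁻¹ * (Complex.Gamma (c - b))⁻¹ *
      (Complex.Gamma (d - a))⁻¹ * (Complex.Gamma (d - b))⁻¹

lemma dougall_big {a b c d : ℂ} (ha : NI a) (hb : NI b) (hc : NI c)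
    (h1 : 1 < (c - a).re) (h2 : 1 < (d - b).re) :
    ∑' n : ℤ, bw a c n * bw b d n = dR a b c d := by
  set v : ℕ → ℂ := fun j => poch (1 + b - d) j / (j.factorial : ℂ) with hv
  have hvs : Summable (fun j => ‖v j‖) := summable_u (by simp at h2 ⊢; linarith)
  have hw := summable_bw ha hc h1
  obtain ⟨K, hK, hKb⟩ := inv_bdd b
  have hsum : Summable (Function.uncurry fun (k : ℕ) (n : ℤ) => v k * (bw a c n * (b + k + n)⁻¹)) := by
    have b1 : Summable (fun x : ℕ × ℤ => ‖v x.1‖ * ‖bw a c x.2‖) :=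
      hvs.mul_of_nonneg hw (fun _ => norm_nonneg _) (fun _ => norm_nonneg _)
    refine Summable.of_norm_bounded (b1.mul_right K) ?_
    rintro ⟨k, n⟩
    simp only [Function.uncurry, norm_mul]
    rw [mul_assoc]
    gcongr
    have := hKb (k + n)
    push_cast at this
    rwa [← add_assoc] at this
  have e1 : ∀ n : ℤ, bw a c n * bw b d n = (Complex.Gamma (d - b))⁻¹ *
      ∑' k : ℕ, v k * (bw a c n * (b + k + n)⁻¹) := by
    intro n
    rw [bw_exp hb h2, mul_left_comm, ← tsum_mul_left]
    simp_rw [hv]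
    congr 2; ext k; ring
  simp_rw [e1]
  rw [tsum_mul_left, hsum.tsum_comm]
  simp_rw [tsum_mul_left]
  have e2 : ∀ k : ℕ, v k * ∑' n : ℤ, bw a c n * (b + k + n)⁻¹ =
      Real.pi^2 / (Complex.sin (Real.pi * a) * Complex.sin (Real.pi * b)) *
        (Complex.Gamma (c - b))⁻¹ * gsT (1 + b - d) (1 + b - c) (1 + b - a) k := by
    intro k
    rw [T_sum ha (hb.addN k) h1, sin_add_nat, gsT]
    have h1 := rGamma_sub (c - b) k
    rw [show c - (b + (k:ℂ)) = c - b - k by ring, h1,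
      show 1 - (c - b) = 1 + b - c by ring, show 1 + (b + (k:ℂ)) - a = 1 + b - a + k by ring, hv]
    have : ((-1:ℂ)^k) ≠ 0 := pow_ne_zero _ (by norm_num)
    field_simp
  simp_rw [e2]
  rw [tsum_mul_left, gauss (by simp at h1 h2 ⊢; linarith), gR, dR,
    show 1 + b - a - (1 + b - d) - (1 + b - c) = c + d - a - b - 1 by ring,
    show 1 + b - a - (1 + b - d) = d - a by ring, show 1 + b - a - (1 + b - c) = c - a by ring]
  ring

/-- bilateral product term -/
noncomputable def dt (a b c d : ℂ) (n : ℤ) : ℂ := bw a c n * bw b d n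

lemma dt_pos_bigO (a b c d : ℂ) :
    (fun n : ℕ => dt a b c d (n+1 : ℕ)) =O[atTop] (fun n : ℕ => (n:ℝ)^((a + b - c - d).re)) := by
  refine ((bw_pos_bigO a c).mul (bw_pos_bigO b d)).congr' (by rfl) ?_
  filter_upwards [eventually_gt_atTop 0] with n hn
  rw [← Real.rpow_add (by exact_mod_cast hn)]
  congr 1; simp; ring

lemma dt_neg_bigO {a b c d : ℂ} (ha : NI a) (hb : NI b) (hc : NI c) (hd : NI d) :
    (fun n : ℕ => dt a b c d (-((n+1 : ℕ) : ℤ))) =O[atTop]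
      (fun n : ℕ => (n:ℝ)^((a + b - c - d).re)) := by
  refine ((bw_neg_bigO ha hc).mul (bw_neg_bigO hb hd)).congr' (by rfl) ?_
  filter_upwards [eventually_gt_atTop 0] with n hn
  rw [← Real.rpow_add (by exact_mod_cast hn)]
  congr 1; simp; ring

lemma dt_summable {a b c d : ℂ} (ha : NI a) (hb : NI b) (hc : NI c) (hd : NI d)
    (h : 0 < (c + d - a - b - 1).re) : Summable (dt a b c d) :=
  (summable_int (by simp at h ⊢; linarith) (dt_pos_bigO a b c d) (dt_neg_bigO ha hb hc hd)).of_norm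

lemma lin_bigO (e : ℂ) (s : ℂ) : (fun n : ℕ => s * (n:ℂ) + e) =O[atTop] (fun n : ℕ => (n:ℝ)) := by
  apply IsBigO.of_bound (‖s‖ + ‖e‖)
  filter_upwards [eventually_gt_atTop 0] with n hn
  have h1 : (1:ℝ) ≤ n := by exact_mod_cast hn
  refine (norm_add_le _ _).trans ?_
  rw [norm_mul, Complex.norm_natCast, Real.norm_natCast]
  nlinarith [norm_nonneg e]

lemma G_aux {f : ℕ → ℂ} {σ : ℝ} (hσ : 0 < σ) {e s : ℂ}
    (hf : f =O[atTop] (fun n : ℕ => (n:ℝ)^(-σ-1))) :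
    Tendsto (fun n => f n * (s * (n:ℂ) + e)) atTop (𝓝 0) := by
  refine ((hf.mul (lin_bigO e s)).congr' (by rfl) ?_).trans_tendsto
    ((tendsto_rpow_neg_atTop hσ).comp tendsto_natCast_atTop_atTop)
  filter_upwards [eventually_gt_atTop 0] with n hn
  have : (0:ℝ) < n := by exact_mod_cast hn
  simp only [Function.comp]
  rw [Real.rpow_sub_one this.ne']
  field_simp

lemma dougall_contig {a b c d : ℂ} (ha : NI a) (hb : NI b) (hc : NI c) (hd : NI d)
    (h : 0 < (c + d - a - b - 1).re) :
    (c - a) * (c - b) * ∑' n, dt a b (c+1) d n = (c + d - a - b - 1) * ∑' n, dt a b c d n := by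
  have hc1 : NI (c+1) := by simpa using hc.add 1
  have hs1 := dt_summable ha hb hc hd h
  have hs2 := dt_summable ha hb hc1 hd (by simp at h ⊢; linarith)
  set G : ℤ → ℂ := fun n => dt a b c d n * (d + n - 1) with hG
  have key : ∀ n : ℤ, (c - a) * (c - b) * dt a b (c+1) d n - (c + d - a - b - 1) * dt a b c d n =
      G (n+1) - G n := by
    intro n
    have g1 := Complex.Gamma_add_one (a + n) (ha.add n).ne_zero
    have g2 := Complex.Gamma_add_one (b + n) (hb.add n).ne_zero
    have g3 := Complex.Gamma_add_one (c + n) (hc.add n).ne_zero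
    have g4 := Complex.Gamma_add_one (d + n) (hd.add n).ne_zero
    have n3 := (hc.add n).ne_zero
    have n4 := (hd.add n).ne_zero
    have k3 := (hc.add n).Gamma
    have k4 := (hd.add n).Gamma
    simp only [hG, dt, bw]
    push_cast
    rw [show c + 1 + (n:ℂ) = c + n + 1 by ring, ← add_assoc, ← add_assoc, ← add_assoc, ← add_assoc,
      g1, g2, g3, g4]
    field_simp
    ring
  have hs := ((hs2.hasSum.mul_left ((c - a) * (c - b))).sub
    (hs1.hasSum.mul_left (c + d - a - b - 1)))
  simp_rw [key] at hs
  have ht := hs.nat_add_neg_add_one.tendsto_sum_nat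
  have hsum : ∀ N : ℕ, ∑ i ∈ Finset.range N, (G ((i:ℤ)+1) - G i + (G (-((i:ℤ)+1) + 1) - G (-((i:ℤ)+1))))
      = G N - G (-(N:ℤ)) := by
    intro N
    induction N with
    | zero => simp
    | succ N ih =>
      rw [Finset.sum_range_succ, ih, show -((N:ℤ)+1)+1 = -(N:ℤ) by ring]
      push_cast
      ring
  simp_rw [hsum] at ht
  have hexp : (a + b - c - d).re = -(c + d - a - b - 1).re - 1 := by simp; ring
  have l1 : Tendsto (fun N : ℕ => G N) atTop (𝓝 0) := by
    rw [← tendsto_add_atTop_iff_nat 1]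
    have := dt_pos_bigO a b c d
    rw [hexp] at this
    refine (G_aux h this (e := d) (s := 1)).congr fun n => ?_
    simp only [hG]; push_cast; ring
  have l2 : Tendsto (fun N : ℕ => G (-(N:ℤ))) atTop (𝓝 0) := by
    rw [← tendsto_add_atTop_iff_nat 1]
    have := dt_neg_bigO ha hb hc hd
    rw [hexp] at this
    refine (G_aux h this (e := d - 2) (s := -1)).congr fun n => ?_
    simp only [hG]; push_cast; ring
  have := tendsto_nhds_unique ht (l1.sub l2)
  linear_combination this

lemma dR_contig {a b c d : ℂ} (h : 0 < (c + d - a - b - 1).re) :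
    (c - a) * (c - b) * dR a b (c+1) d = (c + d - a - b - 1) * dR a b c d := by
  have h0 : c + d - a - b - 1 ≠ 0 := by rintro h1; rw [h1] at h; simp at h
  rw [dR, dR, rGamma_rec (c - a), rGamma_rec (c - b),
    show c + 1 + d - a - b - 1 = c + d - a - b - 1 + 1 by ring, Complex.Gamma_add_one _ h0,
    show c + 1 - a = c - a + 1 by ring, show c + 1 - b = c - b + 1 by ring]
  ring

lemma dougall_down {a b c d : ℂ} (ha : NI a) (hb : NI b) (hc : NI c) (hd : NI d)
    (h : 0 < (c + d - a - b - 1).re) (N : ℕ)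
    (H : ∑' n, dt a b (c+N) d n = dR a b (c+N) d) : ∑' n, dt a b c d n = dR a b c d := by
  induction N generalizing c with
  | zero => simpa using H
  | succ N ih =>
    have h0 : c + d - a - b - 1 ≠ 0 := by rintro h1; rw [h1] at h; simp at h
    have hc1 : NI (c+1) := by simpa using hc.add 1
    have := ih hc1 (by simp at h ⊢; linarith) (by
      rw [show c + 1 + (N:ℂ) = c + (N+1 : ℕ) by push_cast; ring]; exact H)
    apply mul_left_cancel₀ h0
    rw [← dougall_contig ha hb hc hd h, ← dR_contig h, this]

lemma dt_swap (a b c d : ℂ) (n : ℤ) : dt a b c d n = dt a b d c n := by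
  simp only [dt, bw]; ring

lemma dR_swap (a b c d : ℂ) : dR a b c d = dR a b d c := by
  simp only [dR]; rw [add_comm c d]; ring

lemma dougall_all {a b c d : ℂ} (ha : NI a) (hb : NI b) (hc : NI c) (hd : NI d)
    (h : 0 < (c + d - a - b - 1).re) : ∑' n, dt a b c d n = dR a b c d := by
  obtain ⟨M, hM⟩ := exists_nat_gt (1 - (c - a).re)
  obtain ⟨N, hN⟩ := exists_nat_gt (1 - (d - b).re)
  refine dougall_down ha hb hc hd h M ?_
  simp_rw [dt_swap a b (c + M) d]
  rw [dR_swap]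
  have hM0 : (0:ℝ) ≤ M := Nat.cast_nonneg M
  refine dougall_down ha hb hd (hc.addN M) (by simp at h ⊢; linarith) N ?_
  simp_rw [dt_swap a b (d + N)]
  rw [dR_swap]
  exact dougall_big ha hb (hc.addN M) (by simp at hM ⊢; linarith) (by simp at hN ⊢; linarith)

/-- Dougall's ₂H₂ summation. -/
theorem dougall_two_H_two (a b c d : ℂ)
    (ha : ∀ n : ℤ, a ≠ (n : ℂ)) (hb : ∀ n : ℤ, b ≠ (n : ℂ))
    (hc : ∀ n : ℤ, c ≠ (n : ℂ)) (hd : ∀ n : ℤ, d ≠ (n : ℂ))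
    (hre : 0 < (c + d - a - b - 1).re) :
    ∑' n : ℤ, shiftedFact a n * shiftedFact b n / (shiftedFact c n * shiftedFact d n) =
      Complex.Gamma (1 - a) * Complex.Gamma (1 - b) * Complex.Gamma c * Complex.Gamma d *
          Complex.Gamma (c + d - a - b - 1) /
        (Complex.Gamma (c - a) * Complex.Gamma (c - b) * Complex.Gamma (d - a) *
          Complex.Gamma (d - b)) := by
  have ha' : NI a := ha
  have hb' : NI b := hb
  have hc' : NI c := hc
  have hd' : NI d := hd
  have hga := ha'.Gamma
  have hgb := hb'.Gamma
  have hgc := hc'.Gamma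
  have hgd := hd'.Gamma
  have e : ∀ n : ℤ, shiftedFact a n * shiftedFact b n / (shiftedFact c n * shiftedFact d n) =
      Complex.Gamma c * Complex.Gamma d / (Complex.Gamma a * Complex.Gamma b) * dt a b c d n := by
    intro n
    have h3 := (hc'.add n).Gamma
    have h4 := (hd'.add n).Gamma
    simp only [shiftedFact, dt, bw]
    field_simp
  simp_rw [e]
  rw [tsum_mul_left, dougall_all ha' hb' hc' hd' hre, dR]
  have ra : Complex.Gamma (1 - a) = Real.pi / Complex.sin (Real.pi * a) / Complex.Gamma a := by
    rw [← Complex.Gamma_mul_Gamma_one_sub]; field_simp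
  have rb : Complex.Gamma (1 - b) = Real.pi / Complex.sin (Real.pi * b) / Complex.Gamma b := by
    rw [← Complex.Gamma_mul_Gamma_one_sub]; field_simp
  rw [ra, rb]
  simp only [div_eq_mul_inv, mul_inv]
  ring
end

section
/- Specialized Gauss identity (key identity for the ₂H₂ proof): Let a, c ∈ ℂ be non-integers with Re(c - a) > 0. Then for every integer n, with the convention that 1/(1)_m = 0 whenever m < 0, one has ( Γ(1-a) Γ(c) / Γ(c-a) ) · ∑_{k=0}^{∞} (1-c)_k (a)_{n+k} / ( (1)_k (1)_{n+k} ) = (a)_n / (c)_n. -/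
open Filter Topology

/-- Normalised Gamma quotient. -/
noncomputable def sgF (s : ℂ) (n : ℕ) : ℂ :=
  Complex.Gamma (s + n + 1) / ((n : ℂ) ^ s * (n.factorial : ℂ))

lemma sgF_of_ne (s : ℂ) (hs : ∀ m : ℕ, s ≠ -m) :
    Tendsto (sgF s) atTop (𝓝 1) := by
  have h0 := Complex.Gamma_ne_zero hs
  have h := (Complex.GammaSeq_tendsto_Gamma s).inv₀ h0
  have h2 := h.const_mul (Complex.Gamma s)
  rw [mul_inv_cancel₀ h0] at h2
  refine h2.congr fun n => ?_
  have h3 := Complex.Gamma_add_nat_div_Gamma_eq (n := n + 1) s hs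
  have h4 : Complex.Gamma (s + n + 1) = Complex.Gamma s * ∏ j ∈ Finset.range (n + 1), (s + j) := by
    have h5 : ∏ j ∈ Finset.range (n + 1), (s + (j : ℂ)) =
        Polynomial.eval s (ascPochhammer ℂ (n + 1)) := by
      generalize n + 1 = m
      induction m with
      | zero => simp
      | succ m ih => rw [Finset.prod_range_succ, ih, ascPochhammer_succ_eval]
    rw [h5, ← h3]
    push_cast
    rw [add_assoc]
    field_simp
  rw [sgF, h4, Complex.GammaSeq, inv_div, mul_div_assoc]

lemma sgF_down (s : ℂ) (h : Tendsto (sgF (s + 1)) atTop (𝓝 1)) :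
    Tendsto (sgF s) atTop (𝓝 1) := by
  have h1 : Tendsto (fun n : ℕ => 1 + (s + 1) / (n : ℂ)) atTop (𝓝 1) := by
    have := tendsto_const_div_atTop_nhds_zero_nat (𝕜 := ℂ) (s + 1)
    simpa using this.const_add 1
  have h2 := h.div h1 one_ne_zero
  rw [div_one] at h2
  refine h2.congr' ?_
  filter_upwards [eventually_gt_atTop 0, eventually_gt_atTop ⌈‖s + 1‖⌉₊] with n hn hn2
  have hn0 : (n : ℂ) ≠ 0 := by exact_mod_cast hn.ne'
  have hne : s + n + 1 ≠ 0 := by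
    intro h
    have : s + 1 = -(n : ℂ) := by linear_combination h
    have h5 := Nat.lt_of_ceil_lt hn2
    rw [this] at h5
    simp at h5
  simp only [Pi.div_apply, sgF]
  rw [show s + 1 + (n : ℂ) + 1 = (s + n + 1) + 1 by ring, Complex.Gamma_add_one _ hne,
    Complex.cpow_add _ _ hn0, Complex.cpow_one]
  have h6 : (n : ℂ) ^ s ≠ 0 := by simp [Complex.cpow_eq_zero_iff, hn0]
  have h7 : (n.factorial : ℂ) ≠ 0 := by exact_mod_cast n.factorial_ne_zero
  have h8 : 1 + (s + 1) / (n : ℂ) ≠ 0 := by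
    intro h
    apply hne
    field_simp at h
    linear_combination h
  have h9 : (n : ℂ) + (s + 1) ≠ 0 := by
    intro h
    apply hne
    linear_combination h
  field_simp
  ring

lemma sgF_tendsto (s : ℂ) : Tendsto (sgF s) atTop (𝓝 1) := by
  have key : ∀ (m : ℕ) (s : ℂ), 0 < s.re + m → Tendsto (sgF s) atTop (𝓝 1) := by
    intro m
    induction m with
    | zero =>
      intro s hs
      apply sgF_of_ne
      intro k hk
      rw [hk] at hs
      simp at hs
      have : (0 : ℝ) ≤ k := k.cast_nonneg
      linarith
    | succ m ih =>
      intro s hs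
      apply sgF_down
      apply ih
      push_cast at hs
      simp
      linarith
  obtain ⟨m, hm⟩ := exists_nat_gt (-s.re)
  exact key m s (by linarith)

/-- Gauss summand. -/
noncomputable def sgU (A B C : ℂ) (k : ℕ) : ℂ :=
  Complex.Gamma (A + k) * Complex.Gamma (B + k) / ((k.factorial : ℂ) * Complex.Gamma (C + k))

lemma sgU_asymp (A B C : ℂ) :
    Tendsto (fun k : ℕ => ((k + 1 : ℕ) : ℂ) * sgU A B C (k + 1) * (k : ℂ) ^ (C - A - B))
      atTop (𝓝 1) := by
  have h := ((sgF_tendsto A).mul (sgF_tendsto B)).div (sgF_tendsto C) one_ne_zero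
  rw [mul_one, div_one] at h
  refine h.congr' ?_
  filter_upwards [eventually_gt_atTop 0] with n hn
  have hn0 : (n : ℂ) ≠ 0 := by exact_mod_cast hn.ne'
  have h6 : ∀ s : ℂ, (n : ℂ) ^ s ≠ 0 := fun s => by simp [Complex.cpow_eq_zero_iff, hn0]
  have h7 : (n.factorial : ℂ) ≠ 0 := by exact_mod_cast n.factorial_ne_zero
  have h8 : (n : ℂ) + 1 ≠ 0 := by exact_mod_cast n.succ_ne_zero
  simp only [Pi.div_apply, sgF, sgU, Nat.factorial_succ]
  push_cast
  simp only [← add_assoc]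
  rw [Complex.cpow_sub _ _ hn0, Complex.cpow_sub _ _ hn0]
  have := h6 A
  have := h6 B
  have := h6 C
  by_cases hC : Complex.Gamma (C + n + 1) = 0
  · simp [hC]
  · field_simp

lemma sgU_bigO (A B C : ℂ) :
    (fun k : ℕ => ((k + 1 : ℕ) : ℂ) * sgU A B C (k + 1)) =O[atTop]
      (fun k : ℕ => (k : ℝ) ^ (-(C - A - B).re)) := by
  have h := (sgU_asymp A B C).isBigO_one ℝ
  have h1 : (fun k : ℕ => (k : ℂ) ^ (-(C - A - B))) =O[atTop]
      (fun k : ℕ => (k : ℝ) ^ (-(C - A - B).re)) := by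
    apply Asymptotics.IsBigO.of_bound 1
    filter_upwards [eventually_gt_atTop 0] with n hn
    have hn' : (0 : ℝ) < n := by exact_mod_cast hn
    rw [Complex.norm_natCast_cpow_of_pos hn, one_mul, Complex.neg_re]
    exact le_abs_self _
  refine (h.mul h1).congr' ?_ ?_
  · filter_upwards [eventually_gt_atTop 0] with n hn
    have hn0 : (n : ℂ) ≠ 0 := by exact_mod_cast hn.ne'
    rw [mul_assoc, ← Complex.cpow_add _ _ hn0]
    simp
  · filter_upwards with n
    simp

lemma sgU_tendsto (A B C : ℂ) (h : 0 < (C - A - B).re) :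
    Tendsto (fun k : ℕ => (k : ℂ) * sgU A B C k) atTop (𝓝 0) := by
  rw [← tendsto_add_atTop_iff_nat 1]
  exact (sgU_bigO A B C).trans_tendsto ((tendsto_rpow_neg_atTop h).comp tendsto_natCast_atTop_atTop)

lemma sgU_summable (A B C : ℂ) (h : 0 < (C - A - B).re) : Summable (sgU A B C) := by
  rw [← summable_nat_add_iff 1]
  refine summable_of_isBigO_nat (g := fun k : ℕ => (k : ℝ) ^ (-(C - A - B).re - 1)) ?_ ?_
  · rw [Real.summable_nat_rpow]
    linarith
  · have h1 : (fun k : ℕ => (((k + 1 : ℕ) : ℂ))⁻¹) =O[atTop] (fun k : ℕ => (k : ℝ)⁻¹) := by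
      apply Asymptotics.IsBigO.of_bound 1
      filter_upwards [eventually_gt_atTop 0] with n hn
      have hn' : (0 : ℝ) < n := by exact_mod_cast hn
      rw [norm_inv, norm_inv, Complex.norm_natCast, one_mul, Real.norm_of_nonneg hn'.le]
      gcongr
      simp
    refine ((sgU_bigO A B C).mul h1).congr' ?_ ?_
    · filter_upwards with n
      have h8 : ((n + 1 : ℕ) : ℂ) ≠ 0 := by exact_mod_cast n.succ_ne_zero
      field_simp
    · filter_upwards [eventually_gt_atTop 0] with n hn
      have hn' : (n : ℝ) ≠ 0 := by exact_mod_cast hn.ne'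
      rw [Real.rpow_sub_one hn']
      rfl

lemma sgU_C (A B C : ℂ) (k : ℕ) : sgU A B C k = (C + k) * sgU A B (C + 1) k := by
  have h := Complex.one_div_Gamma_eq_self_mul_one_div_Gamma_add_one (C + k)
  simp only [sgU]
  rw [show C + 1 + (k : ℂ) = C + k + 1 by ring]
  simp only [div_eq_mul_inv, mul_inv] at h ⊢
  rw [h]
  ring

lemma sgU_k (A B C : ℂ) (hA : ∀ m : ℕ, A ≠ -m) (hB : ∀ m : ℕ, B ≠ -m) (k : ℕ) :
    ((k + 1 : ℕ) : ℂ) * sgU A B C (k + 1) = (A + k) * (B + k) * sgU A B (C + 1) k := by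
  have h1 : A + k ≠ 0 := fun h => hA k (by linear_combination h)
  have h2 : B + k ≠ 0 := fun h => hB k (by linear_combination h)
  have h8 : (k : ℂ) + 1 ≠ 0 := by exact_mod_cast k.succ_ne_zero
  simp only [sgU, Nat.factorial_succ]
  push_cast
  rw [← add_assoc, ← add_assoc, Complex.Gamma_add_one _ h1, Complex.Gamma_add_one _ h2,
    show C + 1 + (k : ℂ) = C + (k + 1) by ring]
  have h7 : (k.factorial : ℂ) ≠ 0 := by exact_mod_cast k.factorial_ne_zero
  field_simp

lemma sgT_rec (A B C : ℂ) (hA : ∀ m : ℕ, A ≠ -m) (hB : ∀ m : ℕ, B ≠ -m)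
    (h : 0 < (C - A - B).re) :
    (C - A - B) * ∑' k, sgU A B C k = (C - A) * (C - B) * ∑' k, sgU A B (C + 1) k := by
  have h' : 0 < (C + 1 - A - B).re := by
    simp at h ⊢
    linarith
  have s1 := (sgU_summable A B C h).hasSum.mul_left (C - A - B)
  have s2 := (sgU_summable A B (C + 1) h').hasSum.mul_left ((C - A) * (C - B))
  have s3 := (s1.sub s2).tendsto_sum_nat
  have h4 : ∀ N : ℕ, ∑ k ∈ Finset.range N, ((C - A - B) * sgU A B C k -
      (C - A) * (C - B) * sgU A B (C + 1) k) = -((N : ℂ) * sgU A B C N) := by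
    intro N
    induction N with
    | zero => simp
    | succ N ih =>
      rw [Finset.sum_range_succ, ih, sgU_k A B C hA hB, sgU_C A B C]
      ring
  simp only [h4] at s3
  have h5 := (sgU_tendsto A B C h).neg
  rw [neg_zero] at h5
  exact sub_eq_zero.mp (tendsto_nhds_unique s3 h5)

lemma sg_add_nat (A B C : ℂ) (hA : ∀ m : ℕ, A ≠ -m) (hB : ∀ m : ℕ, B ≠ -m)
    (hCA : ∀ m : ℕ, C - A ≠ -m) (hCB : ∀ m : ℕ, C - B ≠ -m)
    (h : 0 < (C - A - B).re) (N : ℕ) :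
    (∑' k, sgU A B (C + N) k) * Complex.Gamma (C + N - A) * Complex.Gamma (C + N - B) /
        Complex.Gamma (C + N - A - B) =
    (∑' k, sgU A B C k) * Complex.Gamma (C - A) * Complex.Gamma (C - B) /
        Complex.Gamma (C - A - B) := by
  induction N with
  | zero => simp
  | succ N ih =>
    rw [← ih]
    have h' : 0 < (C + N - A - B).re := by
      simp at h ⊢
      have : (0 : ℝ) ≤ N := N.cast_nonneg
      linarith
    have h1 : C + N - A - B ≠ 0 := by
      intro h0
      rw [h0] at h'
      simp at h'
    have h2 : C + N - A ≠ 0 := fun h => hCA N (by linear_combination h)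
    have h3 : C + N - B ≠ 0 := fun h => hCB N (by linear_combination h)
    have h4 := sgT_rec A B (C + N) hA hB h'
    push_cast
    rw [← add_assoc, show C + N + 1 - A - B = (C + N - A - B) + 1 by ring,
      show C + N + 1 - A = (C + N - A) + 1 by ring, show C + N + 1 - B = (C + N - B) + 1 by ring,
      Complex.Gamma_add_one _ h1, Complex.Gamma_add_one _ h2, Complex.Gamma_add_one _ h3]
    have h5 := Complex.Gamma_ne_zero_of_re_pos h'
    rw [div_eq_div_iff (mul_ne_zero h1 h5) h5]
    linear_combination (-Complex.Gamma (C + N - A) * Complex.Gamma (C + N - B) * Complex.Gamma (C + N - A - B)) * h4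

lemma sg_ratio (A B C : ℂ) :
    Tendsto (fun N : ℕ => Complex.Gamma (C + (N + 1 : ℕ) - A) * Complex.Gamma (C + (N + 1 : ℕ) - B) /
        (Complex.Gamma (C + (N + 1 : ℕ)) * Complex.Gamma (C + (N + 1 : ℕ) - A - B))) atTop (𝓝 1) := by
  have h := ((sgF_tendsto (C - A)).mul (sgF_tendsto (C - B))).div
    ((sgF_tendsto C).mul (sgF_tendsto (C - A - B))) (by simp)
  simp only [mul_one, div_one] at h
  refine h.congr' ?_
  filter_upwards [eventually_gt_atTop 0] with n hn
  have hn0 : (n : ℂ) ≠ 0 := by exact_mod_cast hn.ne'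
  have h6 : ∀ s : ℂ, (n : ℂ) ^ s ≠ 0 := fun s => by simp [Complex.cpow_eq_zero_iff, hn0]
  have h7 : (n.factorial : ℂ) ≠ 0 := by exact_mod_cast n.factorial_ne_zero
  simp only [Pi.div_apply, sgF]
  push_cast
  rw [show C - A + n + 1 = C + (n + 1) - A by ring, show C - B + n + 1 = C + (n + 1) - B by ring,
    show C - A - B + n + 1 = C + (n + 1) - A - B by ring, show C + n + 1 = C + (n + 1) by ring]
  have h9 : (n : ℂ) ^ (C - A) * (n : ℂ) ^ (C - B) = (n : ℂ) ^ C * (n : ℂ) ^ (C - A - B) := by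
    rw [← Complex.cpow_add _ _ hn0, ← Complex.cpow_add _ _ hn0]
    congr 1
    ring
  rw [div_mul_div_comm, div_mul_div_comm,
    show (n : ℂ) ^ (C - A) * (n.factorial : ℂ) * ((n : ℂ) ^ (C - B) * (n.factorial : ℂ)) =
      (n : ℂ) ^ C * (n.factorial : ℂ) * ((n : ℂ) ^ (C - A - B) * (n.factorial : ℂ)) by
      linear_combination (n.factorial : ℂ) ^ 2 * h9]
  apply div_div_div_cancel_right₀
  have := h6 C
  have := h6 (C - A - B)
  positivity

lemma sg_re (C : ℂ) (hC : 0 < C.re) (k : ℕ) : 0 < (C + k).re := by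
  have : (0 : ℝ) ≤ k := k.cast_nonneg
  simp
  linarith

lemma sg_quot_succ (C : ℂ) (hC : 0 < C.re) (k : ℕ) :
    Complex.Gamma C / Complex.Gamma (C + (k + 1 : ℕ)) =
      Complex.Gamma C / Complex.Gamma (C + k) * (C + k)⁻¹ := by
  have h := sg_re C hC k
  have h0 : C + k ≠ 0 := by
    intro h0
    rw [h0] at h
    simp at h
  push_cast
  rw [← add_assoc, Complex.Gamma_add_one _ h0]
  have := Complex.Gamma_ne_zero_of_re_pos h
  field_simp

lemma sg_quot_bound (C : ℂ) (x : ℝ) (hx : 0 < x) (hC : x ≤ C.re) (k : ℕ) :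
    ‖Complex.Gamma C / Complex.Gamma (C + k)‖ ≤
      ‖Complex.Gamma (x : ℂ) / Complex.Gamma ((x : ℂ) + k)‖ := by
  have hC0 : 0 < C.re := hx.trans_le hC
  have hx0 : 0 < (x : ℂ).re := by simpa using hx
  induction k with
  | zero =>
    simp [div_self (Complex.Gamma_ne_zero_of_re_pos hC0),
      div_self (Complex.Gamma_ne_zero_of_re_pos hx0)]
  | succ k ih =>
    rw [sg_quot_succ C hC0, sg_quot_succ _ hx0, norm_mul, norm_mul]
    refine mul_le_mul ih ?_ (norm_nonneg _) (norm_nonneg _)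
    rw [norm_inv, norm_inv]
    have hk : (0 : ℝ) ≤ k := k.cast_nonneg
    have e : ‖(x : ℂ) + k‖ = x + k := by
      rw [← Complex.ofReal_natCast, ← Complex.ofReal_add, Complex.norm_real,
        Real.norm_of_nonneg (by linarith)]
    rw [e]
    apply inv_anti₀ (by linarith)
    calc x + k ≤ (C + k).re := by simpa using hC
      _ ≤ _ := Complex.re_le_norm _

lemma sg_quot_tendsto (C : ℂ) (k : ℕ) :
    Tendsto (fun N : ℕ => Complex.Gamma (C + N) / Complex.Gamma (C + N + k)) atTop
      (𝓝 (if k = 0 then 1 else 0)) := by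
  obtain ⟨M, hM⟩ := exists_nat_gt (-C.re)
  have hev : ∀ N : ℕ, M ≤ N → 0 < (C + N).re := by
    intro N hN
    have : (M : ℝ) ≤ N := by exact_mod_cast hN
    simp
    linarith
  induction k with
  | zero =>
    simp only [if_true]
    refine tendsto_const_nhds.congr' ?_
    filter_upwards [eventually_ge_atTop M] with N hN
    simp [div_self (Complex.Gamma_ne_zero_of_re_pos (hev N hN))]
  | succ k ih =>
    have h1 : Tendsto (fun N : ℕ => (C + N + k)⁻¹) atTop (𝓝 0) := by
      have : Tendsto (fun N : ℕ => (N : ℂ) + (C + k)) atTop (Bornology.cobounded ℂ) :=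
        (tendsto_add_const_cobounded (C + k)).comp (by
          rw [← tendsto_norm_atTop_iff_cobounded]
          simpa using tendsto_natCast_atTop_atTop (R := ℝ))
      refine (tendsto_inv₀_cobounded.comp this).congr fun N => ?_
      simp only [Function.comp]
      congr 1
      ring
    have h2 := ih.mul h1
    rw [mul_zero] at h2
    simp only [Nat.succ_ne_zero, if_false]
    refine h2.congr' ?_
    filter_upwards [eventually_ge_atTop M] with N hN
    rw [sg_quot_succ _ (hev N hN)]

lemma sg_limit (A B C : ℂ) :
    Tendsto (fun N : ℕ => Complex.Gamma (C + N) * ∑' k, sgU A B (C + N) k) atTop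
      (𝓝 (Complex.Gamma A * Complex.Gamma B)) := by
  obtain ⟨M, hM⟩ := exists_nat_gt (max (-C.re) (A.re + B.re - C.re))
  have hM1 := (le_max_left _ _).trans_lt hM
  have hM2 := (le_max_right _ _).trans_lt hM
  set x : ℝ := C.re + M with hxdef
  have hx : 0 < x := by linarith
  have hs : Summable (sgU A B x) := by
    apply sgU_summable
    simp
    linarith
  have key := tendsto_tsum_of_dominated_convergence (𝓕 := (atTop : Filter ℕ))
    (f := fun (N : ℕ) (k : ℕ) => Complex.Gamma (C + N) * sgU A B (C + N) k)
    (g := fun k : ℕ => if k = 0 then Complex.Gamma A * Complex.Gamma B else 0)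
    (bound := fun k => ‖Complex.Gamma (x : ℂ)‖ * ‖sgU A B x k‖)
    (hs.norm.mul_left _) ?_ ?_
  · rw [tsum_ite_eq] at key
    simpa only [tsum_mul_left] using key
  · intro k
    have h := (sg_quot_tendsto C k).const_mul (Complex.Gamma (A + k) * Complex.Gamma (B + k) / (k.factorial : ℂ))
    have e : (if k = 0 then Complex.Gamma A * Complex.Gamma B else 0) =
      Complex.Gamma (A + k) * Complex.Gamma (B + k) / (k.factorial : ℂ) * (if k = 0 then 1 else 0) := by
      split_ifs with hk
      · simp [hk]
      · simp
    rw [e]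
    refine h.congr fun N => ?_
    simp only [sgU, div_eq_mul_inv, mul_inv]
    ring
  · filter_upwards [eventually_ge_atTop M] with N hN k
    have hb := sg_quot_bound (C + N) x hx (by
      have : (M : ℝ) ≤ N := by exact_mod_cast hN
      simp [hxdef]
      exact hN) k
    have e : ∀ D : ℂ, Complex.Gamma D * sgU A B D k =
      Complex.Gamma (A + k) * Complex.Gamma (B + k) / (k.factorial : ℂ) *
        (Complex.Gamma D / Complex.Gamma (D + k)) := by
      intro D
      simp only [sgU, div_eq_mul_inv, mul_inv]
      ring
    rw [← norm_mul, e, e, norm_mul, norm_mul]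
    gcongr

lemma sg_gauss (A B C : ℂ) (hA : ∀ m : ℕ, A ≠ -m) (hB : ∀ m : ℕ, B ≠ -m)
    (hCA : ∀ m : ℕ, C - A ≠ -m) (hCB : ∀ m : ℕ, C - B ≠ -m)
    (h : 0 < (C - A - B).re) :
    (∑' k, sgU A B C k) * Complex.Gamma (C - A) * Complex.Gamma (C - B) /
        Complex.Gamma (C - A - B) = Complex.Gamma A * Complex.Gamma B := by
  have h1 := (sg_limit A B C).comp (tendsto_add_atTop_nat 1)
  have h2 := h1.mul (sg_ratio A B C)
  rw [mul_one] at h2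
  refine tendsto_nhds_unique (tendsto_const_nhds.congr' ?_) h2
  obtain ⟨M, hM⟩ := exists_nat_gt (-C.re)
  filter_upwards [eventually_ge_atTop M] with N hN
  have hre : 0 < (C + (N + 1 : ℕ)).re := by
    have : (M : ℝ) ≤ N := by exact_mod_cast hN
    simp
    linarith
  have h5 := Complex.Gamma_ne_zero_of_re_pos hre
  rw [← sg_add_nat A B C hA hB hCA hCB h (N + 1)]
  simp only [Function.comp]
  rw [mul_div_assoc', mul_comm (Complex.Gamma (C + (N + 1 : ℕ))) (∑' k, _), mul_assoc _ (Complex.Gamma (C + (N + 1 : ℕ))),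
    mul_left_comm, mul_div_mul_left _ _ h5, mul_assoc]

theorem specialized_gauss (a c : ℂ)
    (ha : ∀ m : ℤ, a ≠ (m : ℂ)) (hc : ∀ m : ℤ, c ≠ (m : ℂ))
    (hre : 0 < (c - a).re) (n : ℤ) :
    Complex.Gamma (1 - a) * Complex.Gamma c / Complex.Gamma (c - a) *
      ∑' k : ℕ, shiftedFact (1 - c) k * shiftedFact a (n + k) /
        (shiftedFact 1 k * shiftedFact 1 (n + k)) =
      shiftedFact a n / shiftedFact c n := by
  have hA : ∀ m : ℕ, 1 - c ≠ -m := fun m h =>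
    hc (1 + m) (by push_cast; linear_combination -h)
  have hB : ∀ m : ℕ, a + n ≠ -m := fun m h =>
    ha (-n - m) (by push_cast; linear_combination h)
  have hCA : ∀ m : ℕ, (n + 1 : ℂ) - (1 - c) ≠ -m := fun m h =>
    hc (-n - m) (by push_cast; linear_combination h)
  have hCB : ∀ m : ℕ, (n + 1 : ℂ) - (a + n) ≠ -m := fun m h =>
    ha (1 + m) (by push_cast; linear_combination -h)
  have e1 : (n + 1 : ℂ) - (1 - c) - (a + n) = c - a := by ring
  have G := sg_gauss (1 - c) (a + n) (n + 1) hA hB hCA hCB (by rw [e1]; exact hre)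
  have ga : Complex.Gamma a ≠ 0 := Complex.Gamma_ne_zero fun m h => ha (-m) (by push_cast; exact h)
  have gc : Complex.Gamma c ≠ 0 := Complex.Gamma_ne_zero fun m h => hc (-m) (by push_cast; exact h)
  have gA := Complex.Gamma_ne_zero hA
  have gCA := Complex.Gamma_ne_zero hCA
  have gCB := Complex.Gamma_ne_zero hCB
  have gca := Complex.Gamma_ne_zero_of_re_pos hre
  have hsum : (∑' k : ℕ, shiftedFact (1 - c) k * shiftedFact a (n + k) /
        (shiftedFact 1 k * shiftedFact 1 (n + k))) =
      (Complex.Gamma (1 - c) * Complex.Gamma a)⁻¹ * ∑' k, sgU (1 - c) (a + n) (n + 1) k := by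
    rw [← tsum_mul_left]
    refine tsum_congr fun k => ?_
    simp only [shiftedFact, sgU, Complex.Gamma_one, div_one]
    push_cast
    rw [← Complex.Gamma_nat_eq_factorial, add_comm (1 : ℂ) k,
      show a + ((n : ℂ) + k) = a + n + k by ring, show (1 : ℂ) + (n + k) = n + 1 + k by ring]
    simp only [div_eq_mul_inv, mul_inv]
    ring
  rw [hsum]
  rw [e1] at G
  rw [show (n + 1 : ℂ) - (1 - c) = c + n by ring, show (n + 1 : ℂ) - (a + n) = 1 - a by ring] at *
  simp only [shiftedFact]
  rw [div_eq_iff gca] at G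
  field_simp
  linear_combination G
end
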